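/- Peleg's intersection lemma: Let I_0 = {1, …, n} and for each i ∈ I_0 let n_i be a natural number with standard basis vectors e^i_0, …, e^i_{n_i} of the simplex Δ_{n_i}. For each i ∈ I_0, let F_i assign to each e^i_j a closed subset F_i(e^i_j) of ∏_{i∈I_0} Δ_{n_i}. Suppose that for every choice of subsets S_i ⊆ {0, 1, …, n_i} (i ∈ I_0), one has ∏_{i∈I_0} co{e^i_j : j ∈ S_i} ⊆ ⋂_{i∈I_0} ⋃_{j∈S_i} F_i(e^i_j). Then ⋂_{i∈I_0} ⋂_{j=0}^{n_i} F_i(e^i_j) ≠ ∅. -/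

import Mathlib

/-- A surjection of a finite set onto a set with one element less identifies exactly one pair. -/
theorem exists_unique_collision {α β : Type*} [DecidableEq α] [DecidableEq β] {f : α → β}
    {S : Finset α} {R : Finset β} (him : S.image f = R) (hc : S.card = R.card + 1) :
    ∃ a ∈ S, ∃ b ∈ S, a ≠ b ∧ f a = f b ∧
      ∀ x ∈ S, ∀ y ∈ S, f x = f y → x = y ∨ (x = a ∧ y = b) ∨ (x = b ∧ y = a) := by
  obtain ⟨a, ha, b, hb, hab, hf⟩ := Finset.exists_ne_map_eq_of_card_lt_of_maps_to
    (s := S) (t := R) (f := f) (by omega)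
    (fun x hx => by rw [← him]; exact Finset.mem_coe.2 (Finset.mem_image_of_mem f hx))
  have himage : (S.erase a).image f = R := by
    rw [← him]
    ext z
    simp only [Finset.mem_image, Finset.mem_erase]
    constructor
    · rintro ⟨x, ⟨-, hx⟩, rfl⟩
      exact ⟨x, hx, rfl⟩
    · rintro ⟨x, hx, rfl⟩
      by_cases h : x = a
      · exact ⟨b, ⟨hab.symm, hb⟩, by rw [h, hf]⟩
      · exact ⟨x, ⟨h, hx⟩, rfl⟩
  have hinj : Set.InjOn f (S.erase a) := by
    rw [← Finset.card_image_iff, himage, Finset.card_erase_of_mem ha]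
    omega
  refine ⟨a, ha, b, hb, hab, hf, fun x hx y hy hxy => ?_⟩
  have key : ∀ z ∈ S, z ≠ a → f z = f a → z = b := fun z hz hza hfz =>
    hinj (by simp [hz, hza]) (by simp [hb, hab.symm]) (hfz.trans hf)
  by_cases hxa : x = a
  · by_cases hya : y = a
    · exact Or.inl (hxa.trans hya.symm)
    · exact Or.inr (Or.inl ⟨hxa, key y hy hya (by rw [← hxy, hxa])⟩)
  · by_cases hya : y = a
    · exact Or.inr (Or.inr ⟨key x hx hxa (by rw [hxy, hya]), hya⟩)
    · exact Or.inl (hinj (by simp [hx, hxa]) (by simp [hy, hya]) hxy)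

/-- A finite set is dominant for the family of orders induced by `r` if no point lies strictly
above its minimum in every order simultaneously. -/
def IsDominant {I V α : Type*} [LE α] (r : I → V → α) (A : Finset V) : Prop :=
  ∀ y, ∃ i, ∀ x ∈ A, r i y ≤ r i x

theorem IsDominant.mono {I V α : Type*} [LE α] {r : I → V → α} {A B : Finset V}
    (hA : IsDominant r A) (h : B ⊆ A) : IsDominant r B := fun y =>
  let ⟨i, hi⟩ := hA y
  ⟨i, fun x hx => hi x (h hx)⟩

/-- The dominant one-point extensions of a dominant set with one element less than the number of
orders: they are the extremal points of the regions obtained by dropping one of two orders. -/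
theorem IsDominant.insert_iff {I V α : Type*} [Fintype I] [DecidableEq I] [DecidableEq V]
    [LinearOrder α] {r : I → V → α} (hr : ∀ i, Function.Injective (r i)) {B : Finset V}
    (hB : IsDominant r B) (hne : B.Nonempty) (hc : B.card + 1 = Fintype.card I) :
    ∃ μ : I → V, (∀ i, μ i ∈ B) ∧ (∀ i, ∀ x ∈ B, r i (μ i) ≤ r i x) ∧ ∃ i₁ i₂, i₁ ≠ i₂ ∧
      ∀ y, (y ∉ B ∧ IsDominant r (insert y B)) ↔ ∃ i, (i = i₁ ∨ i = i₂) ∧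
        (∀ j ≠ i, r j (μ j) < r j y) ∧
          ∀ z, (∀ j ≠ i, r j (μ j) < r j z) → r i z ≤ r i y := by
  choose μ hμB hμ using fun i => B.exists_min_image (r i) hne
  have hsurj : ∀ b ∈ B, ∃ i, μ i = b := fun b hb => by
    obtain ⟨i, hi⟩ := hB b
    exact ⟨i, hr i (le_antisymm (hμ i b hb) (hi _ (hμB i)))⟩
  have him : (Finset.univ : Finset I).image μ = B := by
    ext b
    simp only [Finset.mem_image, Finset.mem_univ, true_and]
    exact ⟨fun ⟨i, hi⟩ => hi ▸ hμB i, hsurj b⟩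
  obtain ⟨i₁, -, i₂, -, h12, hμ12, hpair⟩ :=
    exists_unique_collision him (by rw [Finset.card_univ, hc])
  refine ⟨μ, hμB, hμ, i₁, i₂, h12, fun y => ⟨?_, ?_⟩⟩
  · rintro ⟨hyB, hy⟩
    have hlt : ∀ k, ∃ i, μ i = μ k ∧ r i (μ i) < r i y := fun k => by
      obtain ⟨i, hi⟩ := hy (μ k)
      have hik : μ i = μ k :=
        hr i (le_antisymm (hμ i _ (hμB k)) (hi _ (Finset.mem_insert_of_mem (hμB i))))
      refine ⟨i, hik, lt_of_le_of_ne ?_ fun h => hyB (hr i h ▸ hμB i)⟩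
      rw [hik]
      exact hi y (Finset.mem_insert_self _ _)
    have hother : ∀ k, k ≠ i₁ → k ≠ i₂ → r k (μ k) < r k y := fun k h1 h2 => by
      obtain ⟨i, hi, hlt⟩ := hlt k
      rcases hpair i (Finset.mem_univ _) k (Finset.mem_univ _) hi with h | h | h
      · exact h ▸ hlt
      · exact absurd h.2 h2
      · exact absurd h.2 h1
    have hmax : ∀ i, (∀ j ≠ i, r j (μ j) < r j y) →
        ∀ z, (∀ j ≠ i, r j (μ j) < r j z) → r i z ≤ r i y := fun i _ z hz => by
      obtain ⟨k, hk⟩ := hy z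
      by_cases hki : k = i
      · exact hki ▸ hk y (Finset.mem_insert_self _ _)
      · exact absurd (hk _ (Finset.mem_insert_of_mem (hμB k))) (not_le.2 (hz k hki))
    obtain ⟨i, hi, hlt1⟩ := hlt i₁
    have hi' : i = i₁ ∨ i = i₂ := by
      rcases hpair i (Finset.mem_univ _) i₁ (Finset.mem_univ _) hi with h | h | h
      · exact Or.inl h
      · exact Or.inl h.1
      · exact Or.inr h.1
    rcases hi' with rfl | rfl
    · have h : ∀ j ≠ i₂, r j (μ j) < r j y := fun j hj => by
        by_cases hji : j = i
        · exact hji ▸ hlt1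
        · exact hother j hji hj
      exact ⟨i₂, Or.inr rfl, h, hmax _ h⟩
    · have h : ∀ j ≠ i₁, r j (μ j) < r j y := fun j hj => by
        by_cases hji : j = i
        · exact hji ▸ hlt1
        · exact hother j hj hji
      exact ⟨i₁, Or.inl rfl, h, hmax _ h⟩
  · rintro ⟨i, hi, hlt, hmax⟩
    have hsurj' : ∀ b ∈ B, ∃ j, j ≠ i ∧ μ j = b := fun b hb => by
      obtain ⟨j, rfl⟩ := hsurj b hb
      by_cases hji : j = i
      · rcases hi with rfl | rfl
        · exact ⟨i₂, h12.symm, by rw [hji, hμ12]⟩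
        · exact ⟨i₁, h12, by rw [hji, hμ12]⟩
      · exact ⟨j, hji, rfl⟩
    have hyle : ∀ x ∈ B, r i y ≤ r i x := fun x hx => by
      obtain ⟨k, hk⟩ := hB y
      by_cases hki : k = i
      · exact hki ▸ hk x hx
      · exact absurd (hk _ (hμB k)) (not_le.2 (hlt k hki))
    refine ⟨fun hyB => ?_, fun z => ?_⟩
    · obtain ⟨j, hji, rfl⟩ := hsurj' y hyB
      exact lt_irrefl _ (hlt j hji)
    · by_cases hz : ∀ j ≠ i, r j (μ j) < r j z
      · refine ⟨i, fun x hx => ?_⟩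
        rcases Finset.mem_insert.1 hx with rfl | hx
        · exact hmax z hz
        · exact (hmax z hz).trans (hyle x hx)
      · push Not at hz
        obtain ⟨j, hji, hj⟩ := hz
        refine ⟨j, fun x hx => ?_⟩
        rcases Finset.mem_insert.1 hx with rfl | hx
        · exact hj.trans (hlt j hji).le
        · exact hj.trans (hμ j x hx)

/-- Scarf's combinatorial lemma: for a colouring fixing the slack points `s i`, some dominant set
carries every colour exactly once. -/
theorem exists_colorful_isDominant {I V α : Type*} [Fintype I] [DecidableEq I] [Nonempty I]
    [Fintype V] [DecidableEq V] [LinearOrder α] {r : I → V → α}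
    (hr : ∀ i, Function.Injective (r i)) {s : I → V} {c : V → I} (hcs : ∀ i, c (s i) = i)
    (hmin : ∀ i v, v ≠ s i → r i (s i) < r i v)
    (hmax : ∀ i j v, i ≠ j → v ∉ Set.range s → r i v < r i (s j))
    (hV : ∃ v, v ∉ Set.range s) :
    ∃ A : Finset V, IsDominant r A ∧ A.image c = Finset.univ := by
  classical
  by_contra! hno
  obtain ⟨i₀⟩ := ‹Nonempty I›
  set doors : Finset (Finset V) := Finset.univ.filter fun B =>
    B.card + 1 = Fintype.card I ∧ B.image c = Finset.univ.erase i₀ with hdoors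
  set rooms : Finset (Finset V) := Finset.univ.filter fun A =>
    A.card = Fintype.card I ∧ IsDominant r A with hrooms
  have hsinj : Function.Injective s := fun i j hij => by rw [← hcs i, hij, hcs]
  have hpos : 0 < Fintype.card I := Fintype.card_pos_iff.2 ⟨i₀⟩
  have hle : ∀ i v, r i (s i) ≤ r i v := fun i v => by
    by_cases h : v = s i
    · rw [h]
    · exact (hmin i v h).le
  have hroom_even : ∀ A ∈ rooms, Even (doors.bipartiteBelow (· ⊆ ·) A).card := by
    intro A hA
    obtain ⟨hAc, hAd⟩ : A.card = Fintype.card I ∧ IsDominant r A := by simpa [hrooms] using hA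
    rcases (doors.bipartiteBelow (· ⊆ ·) A).eq_empty_or_nonempty with h0 | ⟨B, hBm⟩
    · simp [h0]
    obtain ⟨⟨-, hBim⟩, hBA⟩ : (B.card + 1 = Fintype.card I ∧ B.image c = Finset.univ.erase i₀) ∧
        B ⊆ A := by simpa [hdoors, Finset.bipartiteBelow] using hBm
    have hAim : A.image c = Finset.univ.erase i₀ := by
      have hsub : Finset.univ.erase i₀ ⊆ A.image c := hBim ▸ Finset.image_subset_image hBA
      refine Finset.Subset.antisymm (fun i hi => ?_) hsub
      refine Finset.mem_erase.2 ⟨?_, Finset.mem_univ _⟩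
      rintro rfl
      refine hno A hAd (Finset.eq_univ_iff_forall.2 fun j => ?_)
      by_cases hj : j = i
      · exact hj ▸ hi
      · exact hsub (by simp [hj])
    obtain ⟨a, ha, b, hb, hab, hcab, hpair⟩ := exists_unique_collision hAim
      (by rw [hAc, Finset.card_erase_of_mem (Finset.mem_univ _), Finset.card_univ]; omega)
    have hset : doors.bipartiteBelow (· ⊆ ·) A = {A.erase a, A.erase b} := by
      ext D
      simp only [hdoors, Finset.bipartiteBelow, Finset.mem_filter, Finset.mem_univ, true_and,
        Finset.mem_insert, Finset.mem_singleton]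
      constructor
      · rintro ⟨⟨hDc, hDim⟩, hDA⟩
        obtain ⟨x, hx⟩ : ∃ x, A \ D = {x} := by
          rw [← Finset.card_eq_one, Finset.card_sdiff_of_subset hDA]
          omega
        have hDx : D = A.erase x := by
          rw [Finset.erase_eq, ← hx, Finset.sdiff_sdiff_eq_self hDA]
        have hxA : x ∈ A := (Finset.mem_sdiff.1 (hx ▸ Finset.mem_singleton_self x)).1
        have hxD : c x ∈ D.image c := by
          rw [hDim, ← hAim]
          exact Finset.mem_image_of_mem c hxA
        obtain ⟨y, hy, hyx⟩ := Finset.mem_image.1 hxD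
        rw [hDx] at hy
        rcases hpair x hxA y (Finset.mem_of_mem_erase hy) hyx.symm with h | h | h
        · exact absurd h.symm (Finset.ne_of_mem_erase hy)
        · exact Or.inl (h.1 ▸ hDx)
        · exact Or.inr (h.1 ▸ hDx)
      · have haux : ∀ x ∈ A, ∀ y ∈ A, x ≠ y → c x = c y →
            (((A.erase x).card + 1 = Fintype.card I ∧
              (A.erase x).image c = Finset.univ.erase i₀) ∧ A.erase x ⊆ A) := by
          intro x hx y hy hxy hcxy
          refine ⟨⟨by rw [Finset.card_erase_add_one hx, hAc], ?_⟩, Finset.erase_subset _ _⟩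
          rw [← hAim]
          refine Finset.Subset.antisymm (Finset.image_subset_image (Finset.erase_subset _ _)) ?_
          intro k hk
          obtain ⟨v, hv, rfl⟩ := Finset.mem_image.1 hk
          by_cases hvx : v = x
          · rw [hvx, hcxy]
            exact Finset.mem_image_of_mem c (Finset.mem_erase.2 ⟨hxy.symm, hy⟩)
          · exact Finset.mem_image_of_mem c (Finset.mem_erase.2 ⟨hvx, hv⟩)
        rintro (rfl | rfl)
        · exact haux a ha b hb hab hcab
        · exact haux b hb a ha hab.symm hcab.symm
    rw [hset, Finset.card_pair]
    · exact even_two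
    · intro h
      have : a ∈ A.erase b := Finset.mem_erase.2 ⟨hab, ha⟩
      rw [← h] at this
      exact Finset.notMem_erase a A this
  have hdoor_card : ∀ B ∈ doors, (rooms.bipartiteAbove (· ⊆ ·) B).card =
      (Finset.univ.filter fun y => y ∉ B ∧ IsDominant r (insert y B)).card := by
    intro B hB
    obtain ⟨hBc, -⟩ : B.card + 1 = Fintype.card I ∧ B.image c = Finset.univ.erase i₀ := by
      simpa [hdoors] using hB
    symm
    refine Finset.card_bij (fun y _ => insert y B) ?_ ?_ ?_
    · intro y hy
      obtain ⟨hyB, hyd⟩ : y ∉ B ∧ IsDominant r (insert y B) := by simpa using hy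
      simp only [hrooms, Finset.bipartiteAbove, Finset.mem_filter, Finset.mem_univ, true_and]
      exact ⟨⟨by rw [Finset.card_insert_of_notMem hyB, hBc], hyd⟩, Finset.subset_insert _ _⟩
    · intro y hy z hz hyz
      have hyB : y ∉ B := (Finset.mem_filter.1 hy).2.1
      have : y ∈ insert z B := hyz ▸ Finset.mem_insert_self y B
      exact (Finset.mem_insert.1 this).resolve_right hyB
    · intro A hA
      obtain ⟨⟨hAc, hAd⟩, hBA⟩ : (A.card = Fintype.card I ∧ IsDominant r A) ∧ B ⊆ A := by
        simpa [hrooms, Finset.bipartiteAbove] using hA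
      obtain ⟨y, hy⟩ : ∃ y, A \ B = {y} := by
        rw [← Finset.card_eq_one, Finset.card_sdiff_of_subset hBA]
        omega
      have hyA : insert y B = A := by
        rw [Finset.insert_eq, ← hy, Finset.sdiff_union_of_subset hBA]
      have hyB : y ∉ B := (Finset.mem_sdiff.1 (hy ▸ Finset.mem_singleton_self y)).2
      exact ⟨y, by simp [hyB, hyA, hAd], hyA⟩
  set B₀ : Finset V := (Finset.univ.erase i₀).image s with hB₀
  have hB₀mem : B₀ ∈ doors := by
    simp only [hdoors, Finset.mem_filter, Finset.mem_univ, true_and, hB₀]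
    refine ⟨?_, ?_⟩
    · rw [Finset.card_image_of_injective _ hsinj,
        Finset.card_erase_add_one (Finset.mem_univ _), Finset.card_univ]
    · rw [Finset.image_image]
      have : c ∘ s = id := funext hcs
      rw [this, Finset.image_id]
  have hB₀card : (rooms.bipartiteAbove (· ⊆ ·) B₀).card = 1 := by
    rw [hdoor_card B₀ hB₀mem]
    obtain ⟨t, ht⟩ := hV
    obtain ⟨y, hy, hymax⟩ := (Finset.univ.filter fun v => v ∉ Set.range s).exists_max_image
      (r i₀) ⟨t, by simpa using ht⟩
    have hyr : y ∉ Set.range s := (Finset.mem_filter.1 hy).2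
    have hsB : ∀ i, i ≠ i₀ → s i ∈ B₀ := fun i hi =>
      Finset.mem_image_of_mem s (Finset.mem_erase.2 ⟨hi, Finset.mem_univ _⟩)
    rw [Finset.card_eq_one]
    refine ⟨y, ?_⟩
    ext z
    simp only [Finset.mem_filter, Finset.mem_univ, true_and, Finset.mem_singleton]
    constructor
    · rintro ⟨hzB, hzd⟩
      obtain ⟨i, hi⟩ := hzd y
      have hii : i = i₀ := by
        by_contra h
        exact not_lt.2 (hi _ (Finset.mem_insert_of_mem (hsB i h)))
          (hmin i y fun h => hyr ⟨i, h.symm⟩)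
      have hyz := hi z (Finset.mem_insert_self _ _)
      rw [hii] at hyz
      have hzr : z ∉ Set.range s := by
        rintro ⟨k, rfl⟩
        by_cases hk : k = i₀
        · rw [hk] at hyz
          exact not_lt.2 hyz (hmin i₀ y fun h => hyr ⟨i₀, h.symm⟩)
        · exact hzB (hsB k hk)
      exact hr i₀ (le_antisymm (hymax z (by simpa using hzr)) hyz)
    · rintro rfl
      refine ⟨fun h => ?_, fun w => ?_⟩
      · obtain ⟨k, -, rfl⟩ := Finset.mem_image.1 h
        exact hyr ⟨k, rfl⟩
      · by_cases hw : w ∈ Set.range s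
        · obtain ⟨k, rfl⟩ := hw
          exact ⟨k, fun x _ => hle k x⟩
        · refine ⟨i₀, fun x hx => ?_⟩
          rcases Finset.mem_insert.1 hx with rfl | hx
          · exact hymax w (by simpa using hw)
          · obtain ⟨k, hk, rfl⟩ := Finset.mem_image.1 hx
            exact (hmax i₀ k w (Finset.ne_of_mem_erase hk).symm hw).le
  have hdoor_even : ∀ B ∈ doors.erase B₀, Even (rooms.bipartiteAbove (· ⊆ ·) B).card := by
    intro B hB
    obtain ⟨hBne, hBmem⟩ := Finset.mem_erase.1 hB
    rw [hdoor_card B hBmem]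
    obtain ⟨hBc, hBim⟩ : B.card + 1 = Fintype.card I ∧ B.image c = Finset.univ.erase i₀ := by
      simpa [hdoors] using hBmem
    by_cases hBd : IsDominant r B
    swap
    · rw [Finset.filter_false_of_mem]
      · simp
      · rintro y - ⟨-, hy⟩
        exact hBd (hy.mono (Finset.subset_insert _ _))
    obtain ⟨v, hvB, hv⟩ : ∃ v ∈ B, v ∉ Set.range s := by
      by_contra! h
      apply hBne
      rw [hB₀, ← hBim, Finset.image_image]
      have : ∀ x ∈ B, (s ∘ c) x = x := fun x hx => by
        obtain ⟨k, rfl⟩ := h x hx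
        simp [hcs]
      rw [Finset.image_congr (g := id) this, Finset.image_id]
    obtain ⟨μ, hμB, hμ, i₁, i₂, h12, hiff⟩ := hBd.insert_iff hr ⟨v, hvB⟩ hBc
    have hext : ∀ i, ∃ y, (∀ j ≠ i, r j (μ j) < r j y) ∧
        ∀ z, (∀ j ≠ i, r j (μ j) < r j z) → r i z ≤ r i y := fun i => by
      obtain ⟨y, hy, hy'⟩ :=
        (Finset.univ.filter fun y => ∀ j ≠ i, r j (μ j) < r j y).exists_max_image (r i)
        ⟨s i, by
          simp only [Finset.mem_filter, Finset.mem_univ, true_and]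
          exact fun j hj => (hμ j v hvB).trans_lt (hmax j i v hj hv)⟩
      exact ⟨y, (Finset.mem_filter.1 hy).2, fun z hz => hy' z (by simpa using hz)⟩
    obtain ⟨y₁, hy₁, hy₁'⟩ := hext i₁
    obtain ⟨y₂, hy₂, hy₂'⟩ := hext i₂
    have hne : y₁ ≠ y₂ := by
      rintro rfl
      obtain ⟨k, hk⟩ := hBd y₁
      refine not_lt.2 (hk _ (hμB k)) ?_
      by_cases h : k = i₁
      · exact hy₂ k (h ▸ h12)
      · exact hy₁ k h
    have hset : (Finset.univ.filter fun y => y ∉ B ∧ IsDominant r (insert y B)) = {y₁, y₂} := by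
      ext y
      simp only [Finset.mem_filter, Finset.mem_univ, true_and, Finset.mem_insert,
        Finset.mem_singleton]
      rw [hiff y]
      constructor
      · rintro ⟨i, rfl | rfl, hlt, hm⟩
        · exact Or.inl (hr _ (le_antisymm (hy₁' y hlt) (hm y₁ hy₁)))
        · exact Or.inr (hr _ (le_antisymm (hy₂' y hlt) (hm y₂ hy₂)))
      · rintro (rfl | rfl)
        · exact ⟨i₁, Or.inl rfl, hy₁, hy₁'⟩
        · exact ⟨i₂, Or.inr rfl, hy₂, hy₂'⟩
    rw [hset, Finset.card_pair hne]
    exact even_two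
  have hsum := Finset.sum_card_bipartiteAbove_eq_sum_card_bipartiteBelow
    (s := doors) (t := rooms) (· ⊆ ·)
  rw [← Finset.add_sum_erase _ _ hB₀mem, hB₀card] at hsum
  have h1 := Finset.even_sum _ hdoor_even
  have h2 := Finset.even_sum _ hroom_even
  rw [← hsum] at h2
  exact absurd h2 (by simpa [Nat.even_add] using h1)

/-- A labelled grid of the simplex contains, near a single grid point, every label whose
coordinate at that point is not small. -/
theorem exists_grid_point {I : Type*} [Fintype I] [DecidableEq I] [Nonempty I] (N : ℕ)
    (c : (I → ℕ) → I) :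
    ∃ t₀ : I → ℕ, ∑ i, t₀ i = N ∧ ∀ i, t₀ i < Fintype.card I ∨
      ∃ t : I → ℕ, ∑ i, t i = N ∧ c t = i ∧
        ∀ k, t k < t₀ k + Fintype.card I ∧ t₀ k < t k + Fintype.card I := by
  classical
  let T := {t : I → ℕ // t ∈ Finset.piAntidiag Finset.univ N}
  let _ : Fintype T := FinsetCoe.fintype _
  have hT : ∀ t : I → ℕ, t ∈ Finset.piAntidiag Finset.univ N ↔ ∑ i, t i = N := fun t => by
    simp [Finset.mem_piAntidiag]
  let e : T ⊕ I ≃ Fin (Fintype.card (T ⊕ I)) := Fintype.equivFin _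
  let h : I → T ⊕ I → ℕ := fun i =>
    Sum.elim (fun t => t.1 i + 1) fun j => if j = i then 0 else N + 2
  let r : I → T ⊕ I → ℕ ×ₗ Fin (Fintype.card (T ⊕ I)) := fun i v => toLex (h i v, e v)
  have hr : ∀ i, Function.Injective (r i) := fun i v w hvw => by
    have := congrArg (fun p => (ofLex p).2) hvw
    exact e.injective this
  have hrlt : ∀ i v w, h i v < h i w → r i v < r i w := fun i v w hvw =>
    Prod.Lex.toLex_lt_toLex.2 (Or.inl hvw)
  have hTle : ∀ (t : T) i, t.1 i ≤ N := fun t i =>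
    (Finset.single_le_sum (f := t.1) (fun _ _ => Nat.zero_le _) (Finset.mem_univ i)).trans_eq
      ((hT t.1).1 t.2)
  obtain ⟨i₀⟩ := ‹Nonempty I›
  let mk : ∀ t : I → ℕ, ∑ i, t i = N → T := fun t ht => ⟨t, (hT t).2 ht⟩
  let q : T := mk (Pi.single i₀ N) (by simp)
  have hslack : ∀ i v, v ≠ Sum.inr i → r i (Sum.inr i) < r i v := by
    rintro i (t | j) hv
    · exact hrlt _ _ _ (by simp [h])
    · have hj : j ≠ i := fun hj => hv (by rw [hj])
      exact hrlt _ _ _ (by simp [h, hj])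
  have : Nonempty I := ⟨i₀⟩
  obtain ⟨A, hA, hcA⟩ := exists_colorful_isDominant (r := r) hr (s := Sum.inr)
    (c := Sum.elim (fun t : T => c t.1) id) (fun _ => rfl) hslack
    (by
      rintro i j (t | k) hij hv
      · have := hTle t i
        exact hrlt _ _ _ (by simp [h, hij.symm]; omega)
      · exact absurd ⟨k, rfl⟩ hv)
    ⟨Sum.inl q, by simp⟩
  have hcol : ∀ i, Sum.inr i ∉ A → ∃ t : T, Sum.inl t ∈ A ∧ c t.1 = i := fun i hi => by
    obtain ⟨v, hv, hvi⟩ := Finset.mem_image.1 (Finset.eq_univ_iff_forall.1 hcA i)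
    rcases v with t | j
    · exact ⟨t, hv, hvi⟩
    · exact absurd hv (by rw [show j = i from hvi]; exact hi)
  obtain ⟨i₁, hi₁⟩ : ∃ i, Sum.inr i ∉ A := by
    by_contra! hall
    obtain ⟨i, hi⟩ := hA (Sum.inl q)
    exact not_lt.2 (hi _ (hall i)) (hslack i _ (by simp))
  obtain ⟨t₀, ht₀, -⟩ := hcol i₁ hi₁
  have ha : ∀ i, ∃ a : ℕ, (∀ t : T, Sum.inl t ∈ A → a ≤ t.1 i) ∧
      (Sum.inr i ∉ A → ∃ t : T, Sum.inl t ∈ A ∧ t.1 i = a) ∧ (Sum.inr i ∈ A → a = 0) := fun i => by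
    by_cases hi : Sum.inr i ∈ A
    · exact ⟨0, fun _ _ => Nat.zero_le _, fun h => absurd hi h, fun _ => rfl⟩
    obtain ⟨t, ht, hmin⟩ := (Finset.univ.filter fun t : T => Sum.inl t ∈ A).exists_min_image
      (fun t => t.1 i) ⟨t₀, by simpa using ht₀⟩
    exact ⟨t.1 i, fun t' ht' => hmin t' (by simpa using ht'),
      fun _ => ⟨t, (Finset.mem_filter.1 ht).2, rfl⟩, fun h => absurd h hi⟩
  choose a hale ha ha0 using ha
  let b : I → ℕ := fun i => if Sum.inr i ∈ A then 0 else a i + 1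
  have hb : N < ∑ i, b i := by
    by_contra! hb
    let y : T := mk (b + Pi.single i₁ (N - ∑ i, b i)) (by
      simp only [Pi.add_apply, Finset.sum_add_distrib, Finset.sum_pi_single', Finset.mem_univ,
        if_true]
      omega)
    obtain ⟨i, hi⟩ := hA (Sum.inl y)
    by_cases hiA : Sum.inr i ∈ A
    · exact not_lt.2 (hi _ hiA) (hslack i _ (by simp))
    · obtain ⟨t, ht, hta⟩ := ha i hiA
      refine not_lt.2 (hi _ ht) (hrlt _ _ _ ?_)
      have : b i ≤ y.1 i := by simp [y, mk]
      have hbi : b i = a i + 1 := by simp [b, hiA]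
      simp only [h, Sum.elim_inl]
      omega
  have hsum : N < ∑ i, a i + Fintype.card I := by
    refine hb.trans_le ?_
    calc ∑ i, b i ≤ ∑ i, (a i + 1) := Finset.sum_le_sum fun i _ => by
          simp only [b]; split_ifs <;> omega
      _ = ∑ i, a i + Fintype.card I := by simp [Finset.sum_add_distrib]
  have hlt : ∀ t : T, Sum.inl t ∈ A → ∀ k, t.1 k < a k + Fintype.card I := fun t ht k => by
    have h1 := (hT t.1).1 t.2
    rw [← Finset.add_sum_erase _ _ (Finset.mem_univ k)] at h1 hsum
    have h2 : ∑ i ∈ Finset.univ.erase k, a i ≤ ∑ i ∈ Finset.univ.erase k, t.1 i :=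
      Finset.sum_le_sum fun i _ => hale i t ht
    omega
  refine ⟨t₀.1, (hT _).1 t₀.2, fun i => ?_⟩
  by_cases hi : Sum.inr i ∈ A
  · left
    simpa [ha0 i hi] using hlt t₀ ht₀ i
  · right
    obtain ⟨t, ht, hct⟩ := hcol i hi
    refine ⟨t.1, (hT _).1 t.2, hct, fun k => ?_⟩
    have := hlt t ht k
    have := hlt t₀ ht₀ k
    have := hale k t ht
    have := hale k t₀ ht₀
    omega

open Filter Topology in
/-- Brouwer's fixed point theorem for the standard simplex. -/
theorem exists_fixedPoint_stdSimplex {I : Type*} [Fintype I] [Nonempty I]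
    {g : stdSimplex ℝ I → stdSimplex ℝ I} (hg : Continuous g) : ∃ x, g x = x := by
  classical
  have hlabel : ∀ x : stdSimplex ℝ I, ∃ i, x.1 i ≤ (g x).1 i := fun x => by
    by_contra! h
    have := Finset.sum_lt_sum_of_nonempty (Finset.univ_nonempty (α := I)) fun i _ => h i
    rw [x.2.2, (g x).2.2] at this
    exact lt_irrefl _ this
  set d : ℝ := (Fintype.card I : ℝ) with hd
  have happrox : ∀ n : ℕ, ∃ x : stdSimplex ℝ I, ∃ w : I → stdSimplex ℝ I, ∀ i,
      dist (w i) x ≤ d * (1 / ((n : ℝ) + 1)) ∧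
        (w i).1 i - d * (1 / ((n : ℝ) + 1)) ≤ (g (w i)).1 i := by
    intro n
    have hn : (0 : ℝ) < (n : ℝ) + 1 := by positivity
    let p : ∀ t : I → ℕ, ∑ i, t i = n + 1 → stdSimplex ℝ I := fun t ht =>
      ⟨fun i => (t i : ℝ) * (1 / ((n : ℝ) + 1)), fun i => by positivity, by
        rw [← Finset.sum_mul, ← Nat.cast_sum, ht]
        push_cast
        field_simp⟩
    choose l hl using hlabel
    let i₀ : I := Classical.arbitrary I
    obtain ⟨t₀, ht₀, h⟩ := exists_grid_point (n + 1) fun t : I → ℕ =>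
      if ht : ∑ i, t i = n + 1 then l (p t ht) else i₀
    have hw : ∀ i, ∃ w : stdSimplex ℝ I, dist w (p t₀ ht₀) ≤ d * (1 / ((n : ℝ) + 1)) ∧
        w.1 i - d * (1 / ((n : ℝ) + 1)) ≤ (g w).1 i := by
      intro i
      rcases h i with hi | ⟨t, ht, hci, htt⟩
      · refine ⟨p t₀ ht₀, by rw [dist_self]; positivity, ?_⟩
        refine le_trans ?_ ((g (p t₀ ht₀)).2.1 i)
        have : (t₀ i : ℝ) ≤ d := by rw [hd]; exact_mod_cast hi.le
        simp only [p, sub_nonpos]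
        gcongr
      · refine ⟨p t ht, ?_, ?_⟩
        · rw [Subtype.dist_eq, dist_pi_le_iff (by positivity)]
          intro k
          obtain ⟨h1, h2⟩ := htt k
          have h1' : (t k : ℝ) ≤ t₀ k + d := by rw [hd]; exact_mod_cast h1.le
          have h2' : (t₀ k : ℝ) ≤ t k + d := by rw [hd]; exact_mod_cast h2.le
          simp only [p]
          rw [Real.dist_eq, ← sub_mul, abs_mul, abs_of_pos (by positivity : 0 < 1 / ((n : ℝ) + 1))]
          gcongr
          rw [abs_le]
          constructor <;> linarith
        · rw [dif_pos ht] at hci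
          have := hl (p t ht)
          rw [hci] at this
          have : 0 ≤ d * (1 / ((n : ℝ) + 1)) := by positivity
          linarith
    choose w hw using hw
    exact ⟨p t₀ ht₀, w, hw⟩
  choose x w hw using happrox
  have : CompactSpace (stdSimplex ℝ I) := isCompact_iff_compactSpace.1 (isCompact_stdSimplex ℝ I)
  obtain ⟨y, -, φ, hφ, hy⟩ := isCompact_univ.tendsto_subseq fun n => Set.mem_univ (x n)
  have hzero : Tendsto (fun n => d * (1 / ((φ n : ℝ) + 1))) atTop (𝓝 0) := by
    simpa using (tendsto_one_div_add_atTop_nhds_zero_nat.comp hφ.tendsto_atTop).const_mul d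
  have hle : ∀ i, y.1 i ≤ (g y).1 i := by
    intro i
    have hwy : Tendsto (fun n => w (φ n) i) atTop (𝓝 y) := by
      refine tendsto_iff_dist_tendsto_zero.2 (squeeze_zero (fun _ => dist_nonneg)
        (fun n => (dist_triangle _ (x (φ n)) y).trans
          (add_le_add (hw (φ n) i).1 le_rfl)) ?_)
      simpa using hzero.add (tendsto_iff_dist_tendsto_zero.1 hy)
    have heval : Continuous fun z : stdSimplex ℝ I => z.1 i :=
      (continuous_apply i).comp continuous_subtype_val
    have h1 := ((heval.tendsto y).comp hwy).sub hzero
    have h2 := ((heval.comp hg).tendsto y).comp hwy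
    rw [sub_zero] at h1
    exact le_of_tendsto_of_tendsto' h1 h2 fun n => (hw (φ n) i).2
  refine ⟨y, Subtype.ext (funext fun i => ?_)⟩
  exact ((Finset.sum_eq_sum_iff_of_le fun i _ => hle i).1
    (y.2.2.trans (g y).2.2.symm) i (Finset.mem_univ i)).symm

/-- Brouwer's fixed point theorem for a finite product of standard simplices. -/
theorem exists_fixedPoint_pi_stdSimplex {ι : Type*} [Fintype ι] {J : ι → Type*}
    [∀ i, Fintype (J i)] [∀ i, Nonempty (J i)]
    {f : (∀ i, stdSimplex ℝ (J i)) → ∀ i, stdSimplex ℝ (J i)} (hf : Continuous f) :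
    ∃ x, f x = x := by
  classical
  rcases isEmpty_or_nonempty ι with hι | hι
  · exact ⟨fun i => hι.elim i, Subsingleton.elim _ _⟩
  have hn : (0 : ℝ) < Fintype.card ι := by exact_mod_cast Fintype.card_pos
  set n : ℝ := (Fintype.card ι : ℝ) with hn'
  let retr : ∀ i, (J i → ℝ) → J i → ℝ := fun i z j =>
    (z j + max 0 (1 - ∑ k, z k) / Fintype.card (J i)) / max 1 (∑ k, z k)
  have hretr : ∀ i (z : J i → ℝ), (∀ j, 0 ≤ z j) → retr i z ∈ stdSimplex ℝ (J i) := by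
    intro i z hz
    refine ⟨fun j => ?_, ?_⟩
    · have := hz j
      simp only [retr]
      positivity
    · have hc : (Fintype.card (J i) : ℝ) ≠ 0 := by exact_mod_cast Fintype.card_ne_zero
      simp only [retr]
      rw [← Finset.sum_div, Finset.sum_add_distrib, Finset.sum_const, Finset.card_univ,
        nsmul_eq_mul, mul_div_cancel₀ _ hc]
      rcases le_total (∑ k, z k) 1 with h | h
      · rw [max_eq_right (by linarith), max_eq_left h]
        ring
      · rw [max_eq_left (by linarith), max_eq_right h, add_zero, div_self (by linarith)]
  have hretr_self : ∀ i (z : stdSimplex ℝ (J i)), retr i z.1 = z.1 := by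
    intro i z
    funext j
    have h : ∑ k, z.1 k = 1 := z.2.2
    simp only [retr, h]
    simp
  let R : stdSimplex ℝ (Σ i, J i) → ∀ i, stdSimplex ℝ (J i) := fun y i =>
    ⟨retr i fun j => n * y.1 ⟨i, j⟩, hretr i _ fun j => mul_nonneg hn.le (y.2.1 _)⟩
  have hR : Continuous R := by
    refine continuous_pi fun i => Continuous.subtype_mk (continuous_pi fun j => ?_) _
    have heval : ∀ k, Continuous fun y : stdSimplex ℝ (Σ i, J i) => y.1 k := fun k =>
      (continuous_apply k).comp continuous_subtype_val
    have hsum : Continuous fun y : stdSimplex ℝ (Σ i, J i) => ∑ k, n * y.1 ⟨i, k⟩ :=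
      continuous_finsetSum _ fun k _ => continuous_const.mul (heval _)
    refine Continuous.div ?_ (continuous_const.max hsum) fun y => ?_
    · exact (continuous_const.mul (heval _)).add
        ((continuous_const.max (continuous_const.sub hsum)).div_const _)
    · exact (lt_max_of_lt_left one_pos).ne'
  let E : (∀ i, stdSimplex ℝ (J i)) → stdSimplex ℝ (Σ i, J i) := fun x =>
    ⟨fun k => (x k.1).1 k.2 / n, fun k => div_nonneg ((x k.1).2.1 _) hn.le, by
      rw [Fintype.sum_sigma]
      have : ∀ i, ∑ j, (x i).1 j / n = 1 / n := fun i => by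
        rw [← Finset.sum_div, (x i).2.2]
      simp only [this, Finset.sum_const, Finset.card_univ, nsmul_eq_mul]
      exact mul_one_div_cancel hn.ne'⟩
  have hE : Continuous E := by
    refine Continuous.subtype_mk (continuous_pi fun k => Continuous.div_const ?_ _) _
    exact (continuous_apply k.2).comp (continuous_subtype_val.comp (continuous_apply k.1))
  have hRE : ∀ x, R (E x) = x := fun x => by
    funext i
    refine Subtype.ext ?_
    have : (fun j => n * (E x).1 ⟨i, j⟩) = (x i).1 := by
      funext j
      exact mul_div_cancel₀ _ hn.ne'
    simp only [R, this]
    exact hretr_self i (x i)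
  have : Nonempty (Σ i, J i) := ⟨⟨Classical.arbitrary ι, Classical.arbitrary _⟩⟩
  obtain ⟨y, hy⟩ := exists_fixedPoint_stdSimplex (hE.comp (hf.comp hR))
  refine ⟨R y, ?_⟩
  have := congrArg R hy
  simpa only [Function.comp_apply, hRE] using this

/-- A point of the standard simplex is a convex combination of the vertices in its support. -/
theorem mem_convexHull_single_support {J : Type*} [Fintype J] [DecidableEq J] {z : J → ℝ}
    (hz : z ∈ stdSimplex ℝ J) :
    z ∈ convexHull ℝ ((fun j => (Pi.single j (1 : ℝ) : J → ℝ)) ''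
      ((Finset.univ.filter fun j => 0 < z j : Finset J) : Set J)) := by
  obtain ⟨S, hS⟩ : ∃ S : Finset J, S = Finset.univ.filter fun j => 0 < z j := ⟨_, rfl⟩
  rw [← hS]
  have hzero : ∀ j, j ∉ S → z j = 0 := fun j hj =>
    le_antisymm (not_lt.1 fun h => hj (by simpa [hS] using h)) (hz.1 j)
  have hsum : ∑ j ∈ S, z j • (Pi.single j (1 : ℝ) : J → ℝ) = z := by
    rw [Finset.sum_subset (Finset.subset_univ _) fun j _ hj => by rw [hzero j hj, zero_smul]]
    exact (pi_eq_sum_univ' z).symm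
  rw [← hsum]
  refine (convex_convexHull ℝ _).sum_mem (fun j _ => hz.1 j) ?_ fun j hj =>
    subset_convexHull ℝ _ (Set.mem_image_of_mem _ hj)
  rw [Finset.sum_subset (Finset.subset_univ _) fun j _ hj => hzero j hj]
  exact hz.2

/-- Peleg's multi-player generalization of the KKM lemma. -/
theorem stmt11 {n : ℕ} (m : Fin n → ℕ)
    (F : ∀ i : Fin n, Fin (m i + 1) →
      Set (∀ i : Fin n, stdSimplex ℝ (Fin (m i + 1))))
    (hF : ∀ i j, IsClosed (F i j))
    (h : ∀ S : ∀ i : Fin n, Finset (Fin (m i + 1)),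
      ∀ x : ∀ i : Fin n, stdSimplex ℝ (Fin (m i + 1)),
        (∀ i, (x i : Fin (m i + 1) → ℝ) ∈
          convexHull ℝ ((fun j => Pi.single j (1 : ℝ)) '' (S i : Set (Fin (m i + 1))))) →
        ∀ i, ∃ j ∈ S i, x ∈ F i j) :
    (⋂ i, ⋂ j, F i j).Nonempty := by
  classical
  have hsupp : ∀ (x : ∀ i : Fin n, stdSimplex ℝ (Fin (m i + 1))) i,
      ∃ j, 0 < (x i).1 j ∧ x ∈ F i j := by
    intro x i
    obtain ⟨j, hj, hxj⟩ := h (fun i => Finset.univ.filter fun j => 0 < (x i).1 j) x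
      (fun i => mem_convexHull_single_support (x i).2) i
    exact ⟨j, (Finset.mem_filter.1 hj).2, hxj⟩
  have hne : ∀ i j, (F i j).Nonempty := by
    intro i j
    let v : ∀ i : Fin n, stdSimplex ℝ (Fin (m i + 1)) :=
      Function.update (fun i => ⟨Pi.single 0 1, single_mem_stdSimplex ℝ 0⟩) i
        ⟨Pi.single j 1, single_mem_stdSimplex ℝ j⟩
    obtain ⟨k, hk, hvk⟩ := hsupp v i
    have hkj : k = j := by
      by_contra hkj
      simp [v, hkj] at hk
    exact ⟨v, hkj ▸ hvk⟩
  let D : ∀ i : Fin n, Fin (m i + 1) → (∀ i, stdSimplex ℝ (Fin (m i + 1))) → ℝ :=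
    fun i j x => Metric.infDist x (F i j)
  have hD : ∀ i j x, 0 ≤ D i j x := fun i j x => Metric.infDist_nonneg
  have hDsum : ∀ i x, 0 < 1 + ∑ k, D i k x := fun i x =>
    add_pos_of_pos_of_nonneg one_pos (Finset.sum_nonneg fun k _ => hD i k x)
  have hDcont : ∀ i j, Continuous (D i j) := fun i j => Metric.continuous_infDist_pt _
  let f : (∀ i, stdSimplex ℝ (Fin (m i + 1))) → ∀ i, stdSimplex ℝ (Fin (m i + 1)) := fun x i =>
    ⟨fun j => ((x i).1 j + D i j x) / (1 + ∑ k, D i k x),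
      fun j => div_nonneg (add_nonneg ((x i).2.1 j) (hD i j x)) (hDsum i x).le, by
        rw [← Finset.sum_div, Finset.sum_add_distrib, (x i).2.2]
        exact div_self (hDsum i x).ne'⟩
  have hf : Continuous f := by
    refine continuous_pi fun i => Continuous.subtype_mk (continuous_pi fun j => ?_) _
    refine Continuous.div ?_ ?_ fun x => (hDsum i x).ne'
    · refine Continuous.add ?_ (hDcont i j)
      exact (continuous_apply j).comp (continuous_subtype_val.comp (continuous_apply i))
    · exact continuous_const.add (continuous_finsetSum _ fun k _ => hDcont i k)
  obtain ⟨x, hx⟩ := exists_fixedPoint_pi_stdSimplex hf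
  refine ⟨x, Set.mem_iInter.2 fun i => Set.mem_iInter.2 fun j => ?_⟩
  have hfix : ∀ k, D i k x = (x i).1 k * ∑ l, D i l x := fun k => by
    have hk : ((x i).1 k + D i k x) / (1 + ∑ l, D i l x) = (x i).1 k :=
      congrFun (congrArg Subtype.val (congrFun hx i)) k
    rw [div_eq_iff (hDsum i x).ne'] at hk
    linarith
  obtain ⟨k, hk, hxk⟩ := hsupp x i
  have hk0 : D i k x = 0 := Metric.infDist_zero_of_mem hxk
  have hsum0 : ∑ l, D i l x = 0 := by
    have := hfix k
    rw [hk0] at this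
    exact (mul_eq_zero.1 this.symm).resolve_left hk.ne'
  refine ((hF i j).mem_iff_infDist_zero (hne i j)).2 ?_
  have := hfix j
  rwa [hsum0, mul_zero] at this
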